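/- Let N : (ℝ⁶)³ → ℝ be trilinear, antisymmetric in its last two arguments, and of type (0,2) with respect to J, i.e. N(Jx, y, z) = N(x, Jy, z) = N(x, y, Jz) for all x, y, z, and let φ be a 3-form on ℝ⁶ satisfying φ(Jx, Jy, z) = −φ(x, y, z) for all x, y, z. Then the 4-form N⊠φ is of type (2,2), i.e. (N⊠φ)(Jx, Jy, Jz, Jw) = (N⊠φ)(x, y, z, w) for all x, y, z, w ∈ ℝ⁶. -/

import Mathlib

noncomputable section

/-- The underlying vector space `ℝ⁶`. -/
abbrev V6 : Type := Fin 6 → ℝ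

/-- The standard basis of `ℝ⁶`. -/
def e6 (i : Fin 6) : V6 := fun j => if j = i then (1 : ℝ) else 0

/-- The standard complex structure `J` with `Je₁=e₂, Je₂=−e₁, Je₃=e₄, Je₄=−e₃, Je₅=e₆,
Je₆=−e₅`. -/
def Jstd (x : V6) : V6 := ![-x 1, x 0, -x 3, x 2, -x 5, x 4]

/-- For a trilinear map `T` antisymmetric in its last two arguments and a 3-form `μ`,
the quadrilinear map `T ⊠ μ` (indices raised with the standard Euclidean metric). -/
def boxt (T μ : V6 → V6 → V6 → ℝ) (x y z w : V6) : ℝ :=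
  ∑ p : Fin 6,
    (T (e6 p) x y * μ (e6 p) z w + T (e6 p) z w * μ (e6 p) x y
      - T (e6 p) x z * μ (e6 p) y w - T (e6 p) y w * μ (e6 p) x z
      + T (e6 p) x w * μ (e6 p) y z + T (e6 p) y z * μ (e6 p) x w)

/-- A 3-form, viewed as a trilinear function of vectors. -/
def ap3 (φ : AlternatingMap ℝ V6 ℝ (Fin 3)) : V6 → V6 → V6 → ℝ :=
  fun x y z => φ ![x, y, z]

theorem Jstd_Jstd (x : V6) : Jstd (Jstd x) = -x := by
  ext i
  fin_cases i <;> simp [Jstd]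

theorem ap3_rotate (φ : AlternatingMap ℝ V6 ℝ (Fin 3)) (x y z : V6) :
    ap3 φ x y z = ap3 φ y z x := by
  have h := φ.map_perm ![x, y, z] (finRotate 3)
  have hsign : Equiv.Perm.sign (finRotate 3) = 1 := by decide
  have hv : ![x, y, z] ∘ finRotate 3 = ![y, z, x] := by
    ext i
    fin_cases i <;> simp [finRotate_apply]
  rw [hsign, one_smul, hv] at h
  exact h.symm

/-- If `N` is trilinear, antisymmetric in its last two arguments and of
type (0,2) with respect to `J`, and the 3-form φ satisfies `φ(Jx,Jy,z) = −φ(x,y,z)`, then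
the 4-form `N ⊠ φ` is of type (2,2). -/
theorem boxtimes_is_type_2_2 (N : V6 →ₗ[ℝ] V6 →ₗ[ℝ] V6 →ₗ[ℝ] ℝ)
    (hanti : ∀ x y z : V6, N x y z = -N x z y)
    (htype1 : ∀ x y z : V6, N (Jstd x) y z = N x (Jstd y) z)
    (htype2 : ∀ x y z : V6, N x (Jstd y) z = N x y (Jstd z))
    (φ : AlternatingMap ℝ V6 ℝ (Fin 3))
    (hφ : ∀ x y z : V6, φ ![Jstd x, Jstd y, z] = -φ ![x, y, z]) :
    ∀ x y z w : V6,
      boxt (fun a b c => N a b c) (ap3 φ) (Jstd x) (Jstd y) (Jstd z) (Jstd w)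
        = boxt (fun a b c => N a b c) (ap3 φ) x y z w := by
  have hN : ∀ p x y : V6, N p (Jstd x) (Jstd y) = -N p x y := fun p x y => by
    rw [htype2, Jstd_Jstd, map_neg]
  have hμ : ∀ p x y : V6, ap3 φ p (Jstd x) (Jstd y) = -ap3 φ p x y := fun p x y => by
    rw [ap3_rotate, ap3_rotate φ p x y]
    exact hφ x y p
  intro x y z w
  simp only [boxt, hN, hμ, neg_mul_neg]
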